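/- arXiv:math/9908161 — 3 statements merged into one kernel-verified Lean document; each statement's English description precedes it below -/
import Mathlib

section
/- Let 𝔣, 𝔣* : ℤ² → ℍ be discrete nets satisfying the dual (Christoffel) relations. Then for every (m,n), setting q := (∂₁𝔣*)_{m,n}(∂₁𝔣)_{m,n}·((∂₂𝔣*)_{m,n}(∂₂𝔣)_{m,n})⁻¹, the cross ratio of the elementary quadrilateral of 𝔣 satisfies Re cr(𝔣_{m,n}, 𝔣_{m+1,n}, 𝔣_{m+1,n+1}, 𝔣_{m,n+1}) = Re q and |Im cr(𝔣_{m,n}, 𝔣_{m+1,n}, 𝔣_{m+1,n+1}, 𝔣_{m,n+1})| = |Im q|. -/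
open Quaternion

noncomputable section

/-- The real quaternions. -/
abbrev H : Type := Quaternion ℝ

/-- A discrete net: at every `(m,n)` the differences `(∂₁𝔣)_{m,n}` and `(∂₂𝔣)_{m,n}` are
nonzero and are not real scalar multiples of one another. -/
def IsNet (f : ℤ → ℤ → H) : Prop :=
  ∀ m n : ℤ, f (m+1) n - f m n ≠ 0 ∧ f m (n+1) - f m n ≠ 0 ∧
    (∀ r : ℝ, f (m+1) n - f m n ≠ r • (f m (n+1) - f m n)) ∧
    (∀ r : ℝ, f m (n+1) - f m n ≠ r • (f (m+1) n - f m n))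

/-- The quaternionic cross ratio `cr(p₁,p₂,p₃,p₄) = (p₁−p₂)(p₂−p₃)⁻¹(p₃−p₄)(p₄−p₁)⁻¹`. -/
def cr (p₁ p₂ p₃ p₄ : H) : H := (p₁ - p₂) * (p₂ - p₃)⁻¹ * (p₃ - p₄) * (p₄ - p₁)⁻¹

/-- Quaternions with the same real part and norm have imaginary parts of the same norm. -/
theorem norm_im_eq_of_re_eq_of_norm_eq {x y : H} (hre : x.re = y.re) (hn : ‖x‖ = ‖y‖) :
    ‖x.im‖ = ‖y.im‖ := by
  have key (z : H) : ‖z.im‖ * ‖z.im‖ = ‖z‖ * ‖z‖ - z.re * z.re := by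
    rw [← Quaternion.normSq_eq_norm_mul_self, ← Quaternion.normSq_eq_norm_mul_self,
      Quaternion.normSq_def', Quaternion.normSq_def']
    simp
    ring
  refine (mul_self_inj (norm_nonneg _) (norm_nonneg _)).1 ?_
  rw [key, key, hre, hn]

/-- The real part of a product of quaternions does not depend on the order of the factors. -/
theorem re_mul_comm (x y : H) : (x * y).re = (y * x).re := by
  simp only [Quaternion.re_mul]
  ring

/-- For a closed quadrilateral with edges `a, c, d, b`, exchanging the first and third factors
of the cross ratio `a c⁻¹ d b⁻¹` preserves the real part. -/
theorem re_mul_inv_mul_mul_inv_swap {a b c d : H} (hb : b ≠ 0) (hc : c ≠ 0)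
    (hclosed : a + c = b + d) :
    (a * c⁻¹ * d * b⁻¹).re = (d * c⁻¹ * a * b⁻¹).re := by
  obtain rfl : d = a + c - b := by rw [hclosed]; abel
  have h₁ : a * c⁻¹ * (a + c - b) * b⁻¹ = a * c⁻¹ * a * b⁻¹ + a * b⁻¹ - a * c⁻¹ := by
    simp only [mul_sub, mul_add, sub_mul, add_mul, inv_mul_cancel_right₀ hc,
      mul_inv_cancel_right₀ hb]
  have h₂ : (a + c - b) * c⁻¹ * a * b⁻¹ =
      a * c⁻¹ * a * b⁻¹ + a * b⁻¹ - b * (c⁻¹ * a * b⁻¹) := by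
    simp only [sub_mul, add_mul, mul_inv_cancel₀ hc, one_mul, mul_assoc]
  have h₃ : (b * (c⁻¹ * a * b⁻¹)).re = (a * c⁻¹).re := by
    rw [re_mul_comm, inv_mul_cancel_right₀ hb, re_mul_comm]
  rw [h₁, h₂, Quaternion.re_sub, Quaternion.re_sub, h₃]

/-- For discrete nets `𝔣, 𝔣*` satisfying the dual (Christoffel) relations, the cross ratio
of an elementary quadrilateral of `𝔣` agrees (up to the usual conjugation-ambiguity of the
imaginary part) with `q = (∂₁𝔣*)(∂₁𝔣)·((∂₂𝔣*)(∂₂𝔣))⁻¹`. -/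
theorem stmt7 (f fs : ℤ → ℤ → H) (hf : IsNet f) (hfs : IsNet fs)
    (hdual : ∀ m n : ℤ,
      (fs (m+1) n - fs m n) * (f (m+1) (n+1) - f (m+1) n)
          = (fs m (n+1) - fs m n) * (f (m+1) (n+1) - f m (n+1)) ∧
      (f (m+1) n - f m n) * (fs (m+1) (n+1) - fs (m+1) n)
          = (f m (n+1) - f m n) * (fs (m+1) (n+1) - fs m (n+1))) :
    ∀ m n : ℤ,
      (cr (f m n) (f (m+1) n) (f (m+1) (n+1)) (f m (n+1))).re
          = ((fs (m+1) n - fs m n) * (f (m+1) n - f m n) *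
              ((fs m (n+1) - fs m n) * (f m (n+1) - f m n))⁻¹).re ∧
      ‖(cr (f m n) (f (m+1) n) (f (m+1) (n+1)) (f m (n+1))).im‖
          = ‖((fs (m+1) n - fs m n) * (f (m+1) n - f m n) *
              ((fs m (n+1) - fs m n) * (f m (n+1) - f m n))⁻¹).im‖ := by
  intro m n
  obtain ⟨-, hb, -, -⟩ := hf m n
  obtain ⟨-, hc, -, -⟩ := hf (m + 1) n
  obtain ⟨-, hB, -, -⟩ := hfs m n
  have hAB := (hdual m n).1
  have hcr : cr (f m n) (f (m+1) n) (f (m+1) (n+1)) (f m (n+1)) =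
      (f (m+1) n - f m n) * (f (m+1) (n+1) - f (m+1) n)⁻¹ *
        (f (m+1) (n+1) - f m (n+1)) * (f m (n+1) - f m n)⁻¹ := by
    rw [cr, ← neg_sub (f (m+1) n) (f m n), ← neg_sub (f (m+1) (n+1)) (f (m+1) n), inv_neg,
      neg_mul_neg]
  have hclosed : (f (m+1) n - f m n) + (f (m+1) (n+1) - f (m+1) n) =
      (f m (n+1) - f m n) + (f (m+1) (n+1) - f m (n+1)) := by abel
  rw [hcr]
  generalize f (m+1) n - f m n = a at *
  generalize f m (n+1) - f m n = b at *
  generalize f (m+1) (n+1) - f (m+1) n = c at *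
  generalize f (m+1) (n+1) - f m (n+1) = d at *
  generalize fs (m+1) n - fs m n = A at *
  generalize fs m (n+1) - fs m n = B at *
  have hq : A * a * (B * b)⁻¹ = B * (d * c⁻¹ * a * b⁻¹) * B⁻¹ := by
    rw [(eq_mul_inv_iff_mul_eq₀ hc).2 hAB, mul_inv_rev]
    simp only [mul_assoc]
  have hre : (a * c⁻¹ * d * b⁻¹).re = (A * a * (B * b)⁻¹).re := by
    rw [hq, re_mul_comm (B * _), inv_mul_cancel_left₀ hB]
    exact re_mul_inv_mul_mul_inv_swap hb hc hclosed
  refine ⟨hre, norm_im_eq_of_re_eq_of_norm_eq hre ?_⟩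
  have hB' : ‖B‖ ≠ 0 := norm_ne_zero_iff.2 hB
  rw [hq]
  simp only [norm_mul, norm_inv]
  field_simp
end
end

section
/- Fix (m,n) ∈ ℤ². Let 𝔣 : ℤ² → ℍ with 𝔣_{m+1,n} ≠ 𝔣_{m,n}, let u ∈ ℍ with a := u·(∂₁𝔣)_{m,n} ∈ ℝ, let λ₁, λ₂ ∈ ℝ with 1 − λ₁a ≠ 0, and let U := f_{m,n}·u·φ_{m+1,n} ∈ M₂(ℍ). Suppose T ∈ GL₂(ℍ) and B ∈ M₂(ℍ) satisfy B·(T f_{m,n}) = (T f_{m,n})·(1 − λ₂·a·(1−λ₁a)⁻¹) and B·(T f_{m+1,n}) = T f_{m+1,n}. Then T⁻¹·B·T·(I + λ₁U) = I + (λ₁+λ₂)U. (This is the algebraic core of the one-parameter group property T^{λ₂}T^{λ₁} = T^{λ₁+λ₂} of the T-transformation, and it yields (T^λ)⁻¹ = T^{−λ}.) -/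
open Quaternion Matrix

noncomputable section

/-- 2×2 quaternionic matrices. -/
abbrev M2 : Type := Matrix (Fin 2) (Fin 2) H

/-- The rank-one matrix `x·q·ψ`, sending a column `y` to `x·q·(ψy)`. -/
def rankOne (x : Fin 2 → H) (q : H) (ψ : Fin 2 → H) : M2 :=
  Matrix.of fun i j => x i * q * ψ j

/-- The column `f_{m,n} = (1, 𝔣_{m,n})ᵀ ∈ ℍ²` associated to `𝔣 : ℤ² → ℍ`. -/
def fvec (f : ℤ → ℤ → H) (m n : ℤ) : Fin 2 → H := ![1, f m n]

/-- The row covector `φ_{m,n} = (−𝔣_{m,n}, 1)` associated to `𝔣 : ℤ² → ℍ`. -/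
def phiv (f : ℤ → ℤ → H) (m n : ℤ) : Fin 2 → H := ![-(f m n), 1]

/-- The rank-one matrix `U_{m,n} = f_{m,n}·u_{m,n}·φ_{m+1,n}`. -/
def Umat (f u : ℤ → ℤ → H) (m n : ℤ) : M2 :=
  rankOne (fvec f m n) (u m n) (phiv f (m+1) n)

/-- The rank-one matrix `V_{m,n} = f_{m,n}·v_{m,n}·φ_{m,n+1}`. -/
def Vmat (f v : ℤ → ℤ → H) (m n : ℤ) : M2 :=
  rankOne (fvec f m n) (v m n) (phiv f m (n+1))

/-- A quaternionic matrix is determined by its values on `(1, p)ᵀ` and `(1, q)ᵀ`, `p ≠ q`. -/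
theorem eq_of_mulVec_affine_eq {M N : M2} {p q : H} (hpq : p ≠ q)
    (hp : M *ᵥ ![1, p] = N *ᵥ ![1, p]) (hq : M *ᵥ ![1, q] = N *ᵥ ![1, q]) : M = N := by
  have key : ∀ i, M i 0 = N i 0 ∧ M i 1 = N i 1 := by
    intro i
    have h₁ : M i 0 + M i 1 * p = N i 0 + N i 1 * p := by
      simpa [mulVec, dotProduct, Fin.sum_univ_two] using congrFun hp i
    have h₂ : M i 0 + M i 1 * q = N i 0 + N i 1 * q := by
      simpa [mulVec, dotProduct, Fin.sum_univ_two] using congrFun hq i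
    have h₃ : (M i 1 - N i 1) * (p - q) = 0 := by
      calc (M i 1 - N i 1) * (p - q)
          = (M i 0 + M i 1 * p) - (M i 0 + M i 1 * q)
            - ((N i 0 + N i 1 * p) - (N i 0 + N i 1 * q)) := by noncomm_ring
        _ = 0 := by rw [h₁, h₂, sub_self]
    have h₄ : M i 1 = N i 1 :=
      sub_eq_zero.mp ((mul_eq_zero.mp h₃).resolve_right (sub_ne_zero.mpr hpq))
    exact ⟨by rw [h₄] at h₁; exact add_right_cancel h₁, h₄⟩
  ext1 i j
  fin_cases j
  exacts [(key i).1, (key i).2]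

theorem rankOne_mulVec (x : Fin 2 → H) (q : H) (ψ y : Fin 2 → H) :
    rankOne x q ψ *ᵥ y = fun i => x i * (q * (ψ ⬝ᵥ y)) := by
  ext1 i
  simp [rankOne, mulVec, dotProduct, Fin.sum_univ_two, mul_add, mul_assoc]

theorem mul_coe_eq_smul (x : Fin 2 → H) (r : ℝ) : (fun k => x k * (r : H)) = r • x := by
  ext1 k
  exact Quaternion.mul_coe_eq_smul r (x k)

/-- The algebraic core of the one-parameter group property `T^{λ₂}T^{λ₁} = T^{λ₁+λ₂}` of the
`T`-transformation: if `B` fixes `Tf_{m+1,n}` and rescales `Tf_{m,n}` by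
`1 − λ₂a(1−λ₁a)⁻¹`, then `T⁻¹BT(I+λ₁U) = I + (λ₁+λ₂)U`. -/
theorem stmt11 (f : ℤ → ℤ → H) (m n : ℤ) (h : f (m+1) n ≠ f m n)
    (u : H) (a l₁ l₂ : ℝ) (ha : u * (f (m+1) n - f m n) = (a : H))
    (hla : 1 - l₁ * a ≠ 0)
    (U : M2) (hU : U = rankOne (fvec f m n) u (phiv f (m+1) n))
    (T S B : M2) (hTS : T * S = 1) (hST : S * T = 1)
    (hB1 : B.mulVec (T.mulVec (fvec f m n))
        = fun k => T.mulVec (fvec f m n) k * ((1 - l₂ * (a * (1 - l₁ * a)⁻¹) : ℝ) : H))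
    (hB2 : B.mulVec (T.mulVec (fvec f (m+1) n)) = T.mulVec (fvec f (m+1) n)) :
    S * B * T * (1 + l₁ • U) = 1 + (l₁ + l₂) • U := by
  set x := fvec f m n with hx
  set y := fvec f (m+1) n with hy
  have hUx : U *ᵥ x = (-a) • x := by
    have hφ : u * (phiv f (m+1) n ⬝ᵥ x) = ((-a : ℝ) : H) := by
      rw [Quaternion.coe_neg, ← ha]
      simp [hx, phiv, fvec, dotProduct, Fin.sum_univ_two]
      noncomm_ring
    rw [hU, rankOne_mulVec, hφ, mul_coe_eq_smul]
  have hUy : U *ᵥ y = 0 := by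
    rw [hU, rankOne_mulVec]
    ext1 i
    simp [hy, phiv, fvec, dotProduct, Fin.sum_univ_two]
  have hCx : (S * B * T) *ᵥ x = (1 - l₂ * (a * (1 - l₁ * a)⁻¹)) • x := by
    rw [← mulVec_mulVec, ← mulVec_mulVec, hB1, mul_coe_eq_smul, mulVec_smul, mulVec_mulVec, hST,
      one_mulVec]
  have hCy : (S * B * T) *ᵥ y = y := by
    rw [← mulVec_mulVec, ← mulVec_mulVec, hB2, mulVec_mulVec, hST, one_mulVec]
  refine eq_of_mulVec_affine_eq h ?_ ?_
  · change _ *ᵥ y = _ *ᵥ y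
    rw [← mulVec_mulVec]
    simp only [add_mulVec, one_mulVec, smul_mulVec, hUy, smul_zero, add_zero, hCy]
  · change _ *ᵥ x = _ *ᵥ x
    rw [← mulVec_mulVec]
    simp only [add_mulVec, one_mulVec, smul_mulVec, hUx, mulVec_add, mulVec_smul, hCx]
    match_scalars
    linear_combination l₂ * a * (-mul_inv_cancel₀ hla)
end
end

section
/- Let s be a quaternionic hermitian form on ℍ². Let 𝔣₁ ≠ 𝔣₂ be quaternions, f₁ := (1, 𝔣₁)ᵀ, f₂ := (1, 𝔣₂)ᵀ ∈ ℍ², φ₂ := (−𝔣₂, 1), and let u ∈ ℍ, a := u·(𝔣₂ − 𝔣₁), U := f₁·u·φ₂ ∈ M₂(ℍ). Assume s(f₁,f₁) = 0 = s(f₂,f₂), s(f₂,f₁) ≠ 0, and let λ ∈ ℝ with λ ≠ 0 and 1 − λa ≠ 0 (so that I + λU is invertible). Then there exists μ ∈ ℝ such that s((I+λU)⁻¹x, (I+λU)⁻¹y) = μ·s(x,y) for all x, y ∈ ℍ² if and only if a is real; in that case μ = (1−λa)⁻¹. (This is the pointwise content of the fact that the T-transformation matrices preserve a fixed 3-sphere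 ℝs if and only if the underlying net is isothermic.) -/
open Quaternion Matrix

noncomputable section

theorem one_add_rankOne_mul (x : Fin 2 → H) (p q : H) (ψ : Fin 2 → H) :
    (1 + rankOne x p ψ) * (1 + rankOne x q ψ) =
      1 + rankOne x (p + q + p * (ψ 0 * x 0 + ψ 1 * x 1) * q) ψ := by
  have h : rankOne x p ψ * rankOne x q ψ =
      rankOne x (p * (ψ 0 * x 0 + ψ 1 * x 1) * q) ψ := by
    ext1 i j
    simp only [rankOne, Matrix.mul_apply, Matrix.of_apply, Fin.sum_univ_two]
    noncomm_ring
  have h' (r t : H) : rankOne x (r + t) ψ = rankOne x r ψ + rankOne x t ψ := by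
    ext1 i j
    simp only [rankOne, Matrix.add_apply, Matrix.of_apply]
    noncomm_ring
  rw [h', h', ← h]
  noncomm_ring

theorem one_add_rankOne_mulVec (x : Fin 2 → H) (q : H) (ψ y : Fin 2 → H) :
    (1 + rankOne x q ψ).mulVec y =
      y + fun k => x k * (q * (ψ 0 * y 0 + ψ 1 * y 1)) := by
  rw [Matrix.add_mulVec, Matrix.one_mulVec]
  congr 1
  funext k
  simp only [rankOne, Matrix.mulVec, dotProduct, Matrix.of_apply, Fin.sum_univ_two]
  noncomm_ring

theorem rankOne_zero (x ψ : Fin 2 → H) : rankOne x 0 ψ = 0 := by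
  ext1 i j
  simp [rankOne]

theorem smul_rankOne (r : ℝ) (x : Fin 2 → H) (q : H) (ψ : Fin 2 → H) :
    r • rankOne x q ψ = rankOne x (r • q) ψ := by
  ext1 i j
  simp [rankOne]

/-- If `d` is a two-sided inverse of `1 + q·(ψx)`, then `I - x·(dq)·ψ` is the inverse of
`I + x·q·ψ`. -/
theorem inverse_one_add_rankOne (x : Fin 2 → H) (q d : H) (ψ : Fin 2 → H)
    (hd : d * (1 + q * (ψ 0 * x 0 + ψ 1 * x 1)) = 1)
    (hd' : (1 + q * (ψ 0 * x 0 + ψ 1 * x 1)) * d = 1) :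
    Ring.inverse (1 + rankOne x q ψ) = 1 + rankOne x (-(d * q)) ψ := by
  set c := ψ 0 * x 0 + ψ 1 * x 1 with hc
  have h₁ : (1 + rankOne x q ψ) * (1 + rankOne x (-(d * q)) ψ) = 1 := by
    have : q + -(d * q) + q * c * -(d * q) = q - (1 + q * c) * d * q := by noncomm_ring
    rw [one_add_rankOne_mul, ← hc, this, hd', one_mul, sub_self, rankOne_zero, add_zero]
  have h₂ : (1 + rankOne x (-(d * q)) ψ) * (1 + rankOne x q ψ) = 1 := by
    have : -(d * q) + q + -(d * q) * c * q = q - d * (1 + q * c) * q := by noncomm_ring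
    rw [one_add_rankOne_mul, ← hc, this, hd, one_mul, sub_self, rankOne_zero, add_zero]
  exact Ring.inverse_unit ⟨_, _, h₁, h₂⟩

/-- The columns `(1, 𝔣₁)ᵀ` and `(1, 𝔣₂)ᵀ` with `𝔣₁ ≠ 𝔣₂` span `ℍ²`. -/
theorem exists_eq_add_of_ne {f₁ f₂ : H} (hne : f₁ ≠ f₂) (x : Fin 2 → H) :
    ∃ α β : H, x = (fun k => (![1, f₁] : Fin 2 → H) k * α) +
      fun k => (![1, f₂] : Fin 2 → H) k * β := by
  have h : f₁ - f₂ ≠ 0 := sub_ne_zero.2 hne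
  refine ⟨(f₁ - f₂)⁻¹ * (x 1 - f₂ * x 0), x 0 - (f₁ - f₂)⁻¹ * (x 1 - f₂ * x 0), ?_⟩
  funext k
  fin_cases k
  · simp
  · have key : (f₁ - f₂) * ((f₁ - f₂)⁻¹ * (x 1 - f₂ * x 0)) = x 1 - f₂ * x 0 :=
      mul_inv_cancel_left₀ h _
    generalize (f₁ - f₂)⁻¹ * (x 1 - f₂ * x 0) = α at key ⊢
    simp only [Fin.mk_one, Pi.add_apply, Matrix.cons_val_one, Matrix.cons_val_fin_one]
    rw [sub_mul] at key
    rw [mul_sub, ← add_sub_assoc, add_sub_right_comm, key, sub_add_cancel]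

/-- The `T`-transformation matrices preserve a fixed hermitian form (up to a real factor) iff
the cross-ratio quantity `a = u(𝔣₂−𝔣₁)` is real; in that case the factor is `(1−λa)⁻¹`. -/
theorem stmt12 (s : (Fin 2 → H) → (Fin 2 → H) → H)
    (hadd₁ : ∀ x x' y, s (x + x') y = s x y + s x' y)
    (hadd₂ : ∀ x y y', s x (y + y') = s x y + s x y')
    (hsc₁ : ∀ x y (c : H), s (fun k => x k * c) y = star c * s x y)
    (hsc₂ : ∀ x y (c : H), s x (fun k => y k * c) = s x y * c)
    (hsymm : ∀ x y, s y x = star (s x y))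
    (f₁ f₂ : H) (hne : f₁ ≠ f₂) (u : H) (a : H) (ha : a = u * (f₂ - f₁))
    (U : M2) (hU : U = rankOne ![1, f₁] u ![-f₂, 1])
    (hs₁ : s ![1, f₁] ![1, f₁] = 0) (hs₂ : s ![1, f₂] ![1, f₂] = 0)
    (hs₂₁ : s ![1, f₂] ![1, f₁] ≠ 0)
    (lam : ℝ) (hlam : lam ≠ 0) (hinv : (1 : H) - (lam : H) * a ≠ 0)
    (W : M2) (hW : W = Ring.inverse (1 + lam • U)) :
    ((∃ μ : ℝ, ∀ x y : Fin 2 → H, s (W.mulVec x) (W.mulVec y) = μ • s x y) ↔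
      ∃ r : ℝ, a = (r : H)) ∧
    (∀ r : ℝ, a = (r : H) →
      ∀ x y : Fin 2 → H, s (W.mulVec x) (W.mulVec y) = ((1 - lam * r)⁻¹ : ℝ) • s x y) := by
  set F₁ : Fin 2 → H := ![1, f₁] with hF₁
  set F₂ : Fin 2 → H := ![1, f₂] with hF₂
  set d : H := (1 - (lam : H) * a)⁻¹ with hd
  have hc : (![-f₂, 1] : Fin 2 → H) 0 * F₁ 0 + (![-f₂, 1] : Fin 2 → H) 1 * F₁ 1 = f₁ - f₂ := by
    simp [F₁]
    abel
  have hqc : (1 : H) + (lam • u) * (f₁ - f₂) = 1 - (lam : H) * a := by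
    rw [ha, Quaternion.coe_mul_eq_smul, smul_mul_assoc, ← neg_sub f₂ f₁, mul_neg, smul_neg,
      ← sub_eq_add_neg]
  have hWr : W = 1 + rankOne F₁ (-(d * (lam • u))) ![-f₂, 1] := by
    rw [hW, hU, smul_rankOne]
    apply inverse_one_add_rankOne
    · rw [hc, hqc, hd, inv_mul_cancel₀ hinv]
    · rw [hc, hqc, hd, mul_inv_cancel₀ hinv]
  have hW₁ (α : H) : W.mulVec (fun k => F₁ k * α) = fun k => F₁ k * (d * α) := by
    have hdc : 1 - d * ((lam • u) * (f₁ - f₂)) = d := by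
      have : d * (1 + (lam • u) * (f₁ - f₂)) = 1 := by rw [hqc, hd, inv_mul_cancel₀ hinv]
      rw [mul_add, mul_one] at this
      rw [← this, add_sub_cancel_right]
    rw [hWr, one_add_rankOne_mulVec]
    funext k
    simp only [Pi.add_apply]
    rw [← mul_assoc _ (F₁ 0) α, ← mul_assoc _ (F₁ 1) α, ← add_mul, hc]
    calc F₁ k * α + F₁ k * (-(d * (lam • u)) * ((f₁ - f₂) * α))
        = F₁ k * ((1 - d * ((lam • u) * (f₁ - f₂))) * α) := by
          generalize lam • u = q
          noncomm_ring
      _ = F₁ k * (d * α) := by rw [hdc]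
  have hW₂ (β : H) : W.mulVec (fun k => F₂ k * β) = fun k => F₂ k * β := by
    rw [hWr, one_add_rankOne_mulVec]
    funext k
    simp [F₂]
  have main (r : ℝ) (har : a = (r : H)) (x y : Fin 2 → H) :
      s (W.mulVec x) (W.mulVec y) = ((1 - lam * r)⁻¹ : ℝ) • s x y := by
    have hdr : d = (((1 - lam * r)⁻¹ : ℝ) : H) := by
      rw [hd, har]
      push_cast
      rfl
    obtain ⟨α, β, rfl⟩ := exists_eq_add_of_ne hne x
    obtain ⟨γ, δ, rfl⟩ := exists_eq_add_of_ne hne y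
    rw [← hF₁, ← hF₂]
    simp only [Matrix.mulVec_add, hW₁, hW₂, hadd₁, hadd₂, hsc₁, hsc₂, hs₁, hs₂]
    simp only [hdr, Quaternion.coe_mul_eq_smul, Quaternion.star_smul, smul_mul_assoc,
      mul_smul_comm, smul_add, mul_zero, zero_mul, smul_zero, add_zero, zero_add]
  refine ⟨⟨?_, fun ⟨r, hr⟩ => ⟨_, main r hr⟩⟩, main⟩
  rintro ⟨μ, hμ⟩
  have h := hμ (fun k => F₂ k * 1) (fun k => F₁ k * 1)
  rw [hW₁, hW₂, hsc₂, hsc₁, hsc₂, hsc₁, star_one, one_mul, mul_one, mul_one,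
    ← Quaternion.mul_coe_eq_smul] at h
  have hdμ : d = (μ : H) := mul_left_cancel₀ hs₂₁ h
  have hlamH : (lam : H) ≠ 0 := fun h => hlam (Quaternion.coe_injective h)
  have hla : (lam : H) * a = ((1 - μ⁻¹ : ℝ) : H) := by
    push_cast
    rw [← hdμ, hd, inv_inv, sub_sub_cancel]
  refine ⟨lam⁻¹ * (1 - μ⁻¹), ?_⟩
  rw [Quaternion.coe_mul, ← hla, Quaternion.coe_inv, inv_mul_cancel_left₀ hlamH]
end
end
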